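/- Let Σ̃ be symmetric positive definite and e ∈ ℝ^d nonzero, and suppose x̃ ~ N(0, Σ̃) with weight w(x̃) = exp(-⟨e, x̃⟩²/τ) where τ = α‖Σ̃^{1/2}e‖² for α > 0. Let μ = (α/(α+2))^{1/2}. Then E[w(x̃) x̃ x̃ᵀ] = μ(Σ̃ - (1-μ²)(Σ̃ e eᵀ Σ̃)/(eᵀ Σ̃ e)). -/

import Mathlib

open MeasureTheory ProbabilityTheory Matrix
open scoped NNReal InnerProductSpace

/-- Tilting the standard Gaussian law by `exp (-x² / α)` gives, up to a constant, the centred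
Gaussian law of variance `α / (α + 2)`. -/
lemma integral_exp_neg_sq_div_mul_gaussianReal {α : ℝ} (hα : 0 < α) {v : ℝ≥0}
    (hv : (v : ℝ) = α / (α + 2)) (f : ℝ → ℝ) :
    ∫ x, Real.exp (-x ^ 2 / α) * f x ∂gaussianReal 0 1 =
      √(v : ℝ) * ∫ x, f x ∂gaussianReal 0 v := by
  have hv0 : 0 < (v : ℝ) := by rw [hv]; positivity
  have hvne : v ≠ 0 := by
    rintro rfl
    simp at hv0
  rw [integral_gaussianReal_eq_integral_smul one_ne_zero,
    integral_gaussianReal_eq_integral_smul hvne, ← integral_const_mul]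
  congr 1 with x
  have hexp : Real.exp (-x ^ 2 / 2) * Real.exp (-x ^ 2 / α) = Real.exp (-x ^ 2 / (2 * v)) := by
    rw [← Real.exp_add, hv]
    congr 1
    field_simp
    ring
  have hsqrt : √(2 * Real.pi * v) = √(2 * Real.pi) * √(v : ℝ) :=
    Real.sqrt_mul (by positivity) _
  have hs : √(v : ℝ) ≠ 0 := (Real.sqrt_pos.2 hv0).ne'
  have hπ : √(2 * Real.pi) ≠ 0 := (Real.sqrt_pos.2 (by positivity)).ne'
  simp only [gaussianPDFReal, NNReal.coe_one, mul_one, sub_zero, smul_eq_mul, hsqrt, ← hexp]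
  field_simp

lemma integral_sq_gaussianReal (v : ℝ≥0) : ∫ x, x * x ∂gaussianReal 0 v = v := by
  have h := variance_fun_id_gaussianReal (μ := 0) (v := v)
  rw [variance_eq_integral measurable_id'.aemeasurable] at h
  simpa [sq] using h

section Pi

variable {ι : Type*} [Fintype ι]

lemma integral_exp_neg_sq_div_mul_eval_mul_eval [DecidableEq ι] {α : ℝ} (hα : 0 < α) {v : ℝ≥0}
    (hv : (v : ℝ) = α / (α + 2)) (i₀ i j : ι) :
    ∫ x : ι → ℝ, Real.exp (-x i₀ ^ 2 / α) * (x i * x j) ∂(Measure.pi fun _ ↦ gaussianReal 0 1) =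
      √(v : ℝ) * if i = j then (if i = i₀ then (v : ℝ) else 1) else 0 := by
  let g (k : ι) (x : ℝ) : ℝ := (if k = i then x else 1) * (if k = j then x else 1)
  let w (k : ι) : ℝ≥0 := if k = i₀ then v else 1
  have hfactor (x : ι → ℝ) : Real.exp (-x i₀ ^ 2 / α) * (x i * x j) =
      ∏ k, (if k = i₀ then Real.exp (-x k ^ 2 / α) else 1) * g k (x k) := by
    simp only [g, Finset.prod_mul_distrib, Finset.prod_ite_eq', Finset.mem_univ, if_true]
  have hcoord (k : ι) :
      ∫ x, (if k = i₀ then Real.exp (-x ^ 2 / α) else 1) * g k x ∂gaussianReal 0 1 =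
        (if k = i₀ then √(v : ℝ) else 1) * ∫ x, g k x ∂gaussianReal 0 (w k) := by
    by_cases hk : k = i₀
    · simpa [hk, w] using integral_exp_neg_sq_div_mul_gaussianReal hα hv (g i₀)
    · simp [hk, w]
  simp_rw [hfactor]
  rw [integral_fintype_prod_eq_prod
    (f := fun k x ↦ (if k = i₀ then Real.exp (-x ^ 2 / α) else 1) * g k x)]
  simp_rw [hcoord, Finset.prod_mul_distrib]
  simp only [Finset.prod_ite_eq', Finset.mem_univ, if_true]
  congr 1
  split_ifs with hij hi
  · subst hij
    rw [Finset.prod_eq_single i (fun k _ hk ↦ by simp [g, hk]) (by simp)]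
    simp [g, w, hi, integral_sq_gaussianReal]
  · subst hij
    rw [Finset.prod_eq_single i (fun k _ hk ↦ by simp [g, hk]) (by simp)]
    simp [g, w, hi, integral_sq_gaussianReal]
  · exact Finset.prod_eq_zero (Finset.mem_univ i) (by simp [g, hij])

lemma integrable_exp_neg_sq_div_mul_eval_mul_eval {α : ℝ} (hα : 0 < α) (i₀ i j : ι) :
    Integrable (fun x : ι → ℝ ↦ Real.exp (-x i₀ ^ 2 / α) * (x i * x j))
      (Measure.pi fun _ ↦ gaussianReal 0 1) := by
  have hmem (k : ι) : MemLp (fun x : ι → ℝ ↦ x k) 2 (Measure.pi fun _ ↦ gaussianReal 0 1) :=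
    (memLp_id_gaussianReal 2).comp_measurePreserving
      (measurePreserving_eval (fun _ ↦ gaussianReal 0 1) k)
  refine ((hmem i).integrable_mul (hmem j)).bdd_mul (c := 1)
    (Measurable.aestronglyMeasurable (by fun_prop)) (ae_of_all _ fun x ↦ ?_)
  rw [Real.norm_eq_abs, Real.abs_exp, Real.exp_le_one_iff, neg_div]
  exact neg_nonpos.2 (by positivity)

end Pi

section InnerProductSpace

variable {E : Type*} [NormedAddCommGroup E] [InnerProductSpace ℝ E] [FiniteDimensional ℝ E]
  [MeasurableSpace E] [BorelSpace E]

lemma integral_exp_neg_inner_basis_sq_div_mul_stdGaussian {ι : Type*} [Fintype ι]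
    (B : OrthonormalBasis ι ℝ E) (i₀ : ι) {α : ℝ} (hα : 0 < α) {v : ℝ≥0}
    (hv : (v : ℝ) = α / (α + 2)) (a b : E) :
    ∫ z, Real.exp (-⟪B i₀, z⟫_ℝ ^ 2 / α) * (⟪a, z⟫_ℝ * ⟪b, z⟫_ℝ) ∂stdGaussian E =
      √(v : ℝ) * (⟪a, b⟫_ℝ - (1 - v) * (⟪B i₀, a⟫_ℝ * ⟪B i₀, b⟫_ℝ)) := by
  classical
  have hinner (c : E) (x : ι → ℝ) : ⟪c, ∑ i, x i • B i⟫_ℝ = ∑ i, x i * ⟪c, B i⟫_ℝ := by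
    simp [inner_sum, real_inner_smul_right]
  have hinner_u (x : ι → ℝ) : ⟪B i₀, ∑ i, x i • B i⟫_ℝ = x i₀ := by
    rw [B.orthonormal.inner_right_fintype]
  have hexpand (x : ι → ℝ) :
      Real.exp (-x i₀ ^ 2 / α) * ((∑ i, x i * ⟪a, B i⟫_ℝ) * ∑ j, x j * ⟪b, B j⟫_ℝ) =
        ∑ i, ∑ j, ⟪a, B i⟫_ℝ * ⟪b, B j⟫_ℝ * (Real.exp (-x i₀ ^ 2 / α) * (x i * x j)) := by
    rw [Finset.sum_mul_sum, Finset.mul_sum]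
    refine Finset.sum_congr rfl fun i _ ↦ ?_
    rw [Finset.mul_sum]
    exact Finset.sum_congr rfl fun j _ ↦ by ring
  have hint (i j : ι) := (integrable_exp_neg_sq_div_mul_eval_mul_eval hα i₀ i j).const_mul
    (⟪a, B i⟫_ℝ * ⟪b, B j⟫_ℝ)
  rw [stdGaussian_eq_map_pi_orthonormalBasis B,
    integral_map (Measurable.aemeasurable (by fun_prop))
      (Measurable.aestronglyMeasurable (by fun_prop))]
  simp_rw [hinner_u, hinner, hexpand]
  rw [integral_finsetSum _ fun i _ ↦ integrable_finsetSum _ fun j _ ↦ hint i j]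
  simp_rw [integral_finsetSum _ fun j _ ↦ hint _ j, integral_const_mul,
    integral_exp_neg_sq_div_mul_eval_mul_eval hα hv]
  have hab : ∑ i, ⟪a, B i⟫_ℝ * ⟪b, B i⟫_ℝ = ⟪a, b⟫_ℝ := by
    rw [← B.sum_inner_mul_inner a b]
    exact Finset.sum_congr rfl fun i _ ↦ by rw [real_inner_comm b]
  have hterm (i : ι) : ⟪a, B i⟫_ℝ * ⟪b, B i⟫_ℝ * (√(v : ℝ) * if i = i₀ then (v : ℝ) else 1) =
      √(v : ℝ) * (⟪a, B i⟫_ℝ * ⟪b, B i⟫_ℝ -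
        if i = i₀ then (1 - v) * (⟪a, B i⟫_ℝ * ⟪b, B i⟫_ℝ) else 0) := by
    split_ifs <;> ring
  simp only [mul_ite, mul_zero, Finset.sum_ite_eq, Finset.mem_univ, if_true] at hterm ⊢
  simp_rw [hterm, ← Finset.mul_sum, Finset.sum_sub_distrib, hab]
  simp [real_inner_comm]

lemma integral_exp_neg_inner_sq_div_mul_stdGaussian_of_norm_eq_one {α : ℝ} (hα : 0 < α) {v : ℝ≥0}
    (hv : (v : ℝ) = α / (α + 2)) {u : E} (hu : ‖u‖ = 1) (a b : E) :
    ∫ z, Real.exp (-⟪u, z⟫_ℝ ^ 2 / α) * (⟪a, z⟫_ℝ * ⟪b, z⟫_ℝ) ∂stdGaussian E =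
      √(v : ℝ) * (⟪a, b⟫_ℝ - (1 - v) * (⟪u, a⟫_ℝ * ⟪u, b⟫_ℝ)) := by
  have hu' : Orthonormal ℝ ((↑) : ({u} : Set E) → E) :=
    ⟨by simp [hu], fun i j hij ↦ (hij (Subsingleton.elim i j)).elim⟩
  obtain ⟨s, B, hus, hB⟩ := hu'.exists_orthonormalBasis_extension
  have hBu : B ⟨u, by simpa using hus⟩ = u := by simp [hB]
  simpa only [hBu] using
    integral_exp_neg_inner_basis_sq_div_mul_stdGaussian B ⟨u, by simpa using hus⟩ hα hv a b

lemma integral_exp_neg_inner_sq_div_mul_stdGaussian {α : ℝ} (hα : 0 < α) {v : ℝ≥0}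
    (hv : (v : ℝ) = α / (α + 2)) {u : E} (hu : u ≠ 0) (a b : E) :
    ∫ z, Real.exp (-⟪u, z⟫_ℝ ^ 2 / (α * ‖u‖ ^ 2)) * (⟪a, z⟫_ℝ * ⟪b, z⟫_ℝ) ∂stdGaussian E =
      √(v : ℝ) * (⟪a, b⟫_ℝ - (1 - v) / ‖u‖ ^ 2 * (⟪u, a⟫_ℝ * ⟪u, b⟫_ℝ)) := by
  have hu0 : ‖u‖ ≠ 0 := norm_ne_zero_iff.2 hu
  have h := integral_exp_neg_inner_sq_div_mul_stdGaussian_of_norm_eq_one hα hv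
    (u := ‖u‖⁻¹ • u) (by simp [norm_smul, hu0]) a b
  simp only [real_inner_smul_left] at h
  have hexp (z : E) : -(‖u‖⁻¹ * ⟪u, z⟫_ℝ) ^ 2 / α = -⟪u, z⟫_ℝ ^ 2 / (α * ‖u‖ ^ 2) := by
    field_simp
  simp_rw [hexp] at h
  rw [h]
  field_simp

end InnerProductSpace

/-- Weighted covariance for a general Gaussian: let `Σ̃` be symmetric positive definite
with positive-semidefinite square root `S` (so `x̃ = S z ~ N(0, Σ̃)` for `z ~ N(0, I)`),
`e ≠ 0`, `τ = α‖Σ̃^{1/2}e‖²`, `w(x̃) = exp(-⟨e,x̃⟩²/τ)`, and `μ = (α/(α+2))^{1/2}`. Then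
`E[w(x̃) x̃ x̃ᵀ] = μ(Σ̃ - (1-μ²)(Σ̃ e eᵀ Σ̃)/(eᵀ Σ̃ e))`. -/
theorem stmt_9 (d : ℕ)
    (St S : Matrix (Fin d) (Fin d) ℝ)
    (hStpd : St.PosDef)
    (hS : S.PosSemidef) (hSsq : S * S = St)
    (e : Fin d → ℝ) (he : e ≠ 0)
    (α : ℝ) (hα : 0 < α)
    (τ : ℝ) (hτ : τ = α * (S.mulVec e ⬝ᵥ S.mulVec e))
    (μ : ℝ) (hμ : μ = (α / (α + 2)) ^ ((1 : ℝ) / 2))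
    (M : Matrix (Fin d) (Fin d) ℝ)
    (hM : ∀ i j, M i j =
      ∫ z : Fin d → ℝ,
        Real.exp (-(e ⬝ᵥ S.mulVec z) ^ 2 / τ) * (S.mulVec z i * S.mulVec z j)
        ∂(Measure.pi fun _ : Fin d => gaussianReal 0 1)) :
    M = μ • (St - ((1 - μ ^ 2) / (e ⬝ᵥ St.mulVec e)) • (St * vecMulVec e e * St)) := by
  let v : ℝ≥0 := ⟨α / (α + 2), by positivity⟩
  have hv : (v : ℝ) = α / (α + 2) := rfl
  have hμv : μ = √(v : ℝ) := by rw [hμ, Real.sqrt_eq_rpow, hv]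
  have hμsq : μ ^ 2 = v := by rw [hμv, Real.sq_sqrt v.coe_nonneg]
  have hsymm (i j : Fin d) : S i j = S j i := by simpa using hS.isHermitian.apply j i
  have hST : Sᵀ = S := by ext i j; exact hsymm j i
  have hStT : Stᵀ = St := by rw [← hSsq, transpose_mul, hST]
  let u : EuclideanSpace ℝ (Fin d) := WithLp.toLp 2 (S *ᵥ e)
  let r (i : Fin d) : EuclideanSpace ℝ (Fin d) := WithLp.toLp 2 (S i)
  have hinner_r (i : Fin d) (z : Fin d → ℝ) : (S *ᵥ z) i = ⟪r i, WithLp.toLp 2 z⟫_ℝ := by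
    simp [r, EuclideanSpace.inner_toLp_toLp, mulVec, dotProduct_comm]
  have hinner_u (z : Fin d → ℝ) : e ⬝ᵥ S *ᵥ z = ⟪u, WithLp.toLp 2 z⟫_ℝ := by
    rw [dotProduct_mulVec, ← mulVec_transpose, hST]
    simp [u, EuclideanSpace.inner_toLp_toLp, dotProduct_comm]
  have hnorm : S *ᵥ e ⬝ᵥ S *ᵥ e = ‖u‖ ^ 2 := by
    rw [← real_inner_self_eq_norm_sq, EuclideanSpace.inner_toLp_toLp, star_trivial]
  have hquad : e ⬝ᵥ St *ᵥ e = ‖u‖ ^ 2 := by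
    rw [← hSsq, ← mulVec_mulVec, hinner_u, ← real_inner_self_eq_norm_sq]
  have hu : u ≠ 0 := by
    have hpos : 0 < e ⬝ᵥ St *ᵥ e := by simpa using hStpd.dotProduct_mulVec_pos he
    rintro hu
    simp [hquad, hu] at hpos
  have hru (i : Fin d) : ⟪u, r i⟫_ℝ = (St *ᵥ e) i := by
    rw [← hSsq, ← mulVec_mulVec, hinner_r, real_inner_comm]
  have hrr (i j : Fin d) : ⟪r i, r j⟫_ℝ = St i j := by
    rw [← hinner_r, ← hSsq, mul_apply, mulVec, dotProduct]
    exact Finset.sum_congr rfl fun k _ ↦ by rw [hsymm j k]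
  have houter : St * vecMulVec e e * St = vecMulVec (St *ᵥ e) (St *ᵥ e) := by
    rw [mul_vecMulVec, vecMulVec_mul, ← mulVec_transpose, hStT]
  ext i j
  have key := integral_exp_neg_inner_sq_div_mul_stdGaussian hα hv hu (r i) (r j)
  rw [← map_pi_eq_stdGaussian, integral_map (Measurable.aemeasurable (by fun_prop))
    (Measurable.aestronglyMeasurable (by fun_prop))] at key
  simp_rw [hM, hτ, hnorm, hinner_u, hinner_r]
  rw [key, houter, hquad, hμsq, hμv, hrr, hru, hru]
  simp [vecMulVec_apply]
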